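/- arXiv:math/0505257 — 5 statements merged into one kernel-verified Lean document; each statement's English description precedes it below -/
import Mathlib

section
/- (Polarized Gårding inequality for σ₂.) Let n ≥ 2 and let A, B be real symmetric n×n matrices that both lie in Γ₂⁺ (i.e. tr A > 0, σ₂(A) > 0, tr B > 0, σ₂(B) > 0). Then tr( ((tr A)·Iₙ − A) · B ) ≥ 2 √(σ₂(A) · σ₂(B)). Here (tr A)·Iₙ − A is exactly the matrix of partial derivatives (∂σ₂/∂A_{ij})(A). -/
open scoped BigOperators

/-- `σ₂` of a matrix: `((tr M)² − tr(M²))/2`, which equals the second elementary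
symmetric function of the eigenvalues when `M` is symmetric. -/
noncomputable def sigma2Mat {n : ℕ} (A : Matrix (Fin n) (Fin n) ℝ) : ℝ :=
  (A.trace ^ 2 - (A * A).trace) / 2

/-- The trace of `M * N` as a sum over pairs of indices, for symmetric `N`. -/
theorem Matrix.IsSymm.trace_mul_eq_sum {ι : Type*} [Fintype ι] {N : Matrix ι ι ℝ}
    (hN : N.IsSymm) (M : Matrix ι ι ℝ) :
    (M * N).trace = ∑ x : ι × ι, M x.1 x.2 * N x.1 x.2 := by
  rw [Fintype.sum_prod_type]
  simp only [Matrix.trace, Matrix.diag_apply, Matrix.mul_apply]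
  exact Finset.sum_congr rfl fun i _ => Finset.sum_congr rfl fun j _ => by rw [hN.apply]

theorem Matrix.IsSymm.trace_mul_self_nonneg {ι : Type*} [Fintype ι] {M : Matrix ι ι ℝ}
    (hM : M.IsSymm) : 0 ≤ (M * M).trace := by
  rw [hM.trace_mul_eq_sum]
  exact Finset.sum_nonneg fun x _ => mul_self_nonneg _

/-- Cauchy-Schwarz inequality for the trace form on symmetric matrices. -/
theorem Matrix.IsSymm.trace_mul_sq_le {ι : Type*} [Fintype ι] {M N : Matrix ι ι ℝ}
    (hM : M.IsSymm) (hN : N.IsSymm) :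
    (M * N).trace ^ 2 ≤ (M * M).trace * (N * N).trace := by
  rw [hN.trace_mul_eq_sum, hM.trace_mul_eq_sum, hN.trace_mul_eq_sum]
  simpa only [sq] using Finset.sum_mul_sq_le_sq_mul_sq Finset.univ
    (fun x : ι × ι => M x.1 x.2) (fun x : ι × ι => N x.1 x.2)

/-- Reversed Cauchy-Schwarz (Aczél) inequality for a Lorentzian form. -/
theorem lorentz_reverse_cauchy_schwarz {a b p q r : ℝ} (ha : 0 < a) (hb : 0 < b)
    (hp : 0 ≤ p) (hq : 0 ≤ q) (hpa : p < a ^ 2) (hqb : q < b ^ 2) (hr : r ^ 2 ≤ p * q) :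
    0 ≤ a * b - r ∧ (a ^ 2 - p) * (b ^ 2 - q) ≤ (a * b - r) ^ 2 := by
  obtain ⟨x, hx, rfl⟩ : ∃ x, 0 ≤ x ∧ x ^ 2 = p := ⟨√p, Real.sqrt_nonneg p, Real.sq_sqrt hp⟩
  obtain ⟨y, hy, rfl⟩ : ∃ y, 0 ≤ y ∧ y ^ 2 = q := ⟨√q, Real.sqrt_nonneg q, Real.sq_sqrt hq⟩
  have hxa : x ≤ a := (pow_le_pow_iff_left₀ hx ha.le two_ne_zero).1 hpa.le
  have hyb : y ≤ b := (pow_le_pow_iff_left₀ hy hb.le two_ne_zero).1 hqb.le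
  have hrxy : r ≤ x * y := abs_le_of_sq_le_sq (by rwa [mul_pow]) (mul_nonneg hx hy) |> (le_abs_self r).trans
  have hab : x * y ≤ a * b := mul_le_mul hxa hyb hy ha.le
  refine ⟨by linarith, ?_⟩
  calc (a ^ 2 - x ^ 2) * (b ^ 2 - y ^ 2) ≤ (a * b - x * y) ^ 2 := by
        nlinarith [sq_nonneg (a * y - b * x)]
    _ ≤ (a * b - r) ^ 2 := pow_le_pow_left₀ (by linarith) (by linarith) 2

/-- Polarized Gårding inequality for `σ₂`:
`tr(((tr A)Iₙ − A)·B) ≥ 2√(σ₂(A)σ₂(B))` for symmetric `A, B ∈ Γ₂⁺`. -/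
theorem stmt_2 (n : ℕ) (hn : 2 ≤ n) (A B : Matrix (Fin n) (Fin n) ℝ)
    (hAsymm : A.IsSymm) (hBsymm : B.IsSymm)
    (hA1 : 0 < A.trace) (hA2 : 0 < sigma2Mat A)
    (hB1 : 0 < B.trace) (hB2 : 0 < sigma2Mat B) :
    2 * Real.sqrt (sigma2Mat A * sigma2Mat B) ≤
      ((A.trace • (1 : Matrix (Fin n) (Fin n) ℝ) - A) * B).trace := by
  have htrace : ((A.trace • (1 : Matrix (Fin n) (Fin n) ℝ) - A) * B).trace =
      A.trace * B.trace - (A * B).trace := by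
    simp [sub_mul, Matrix.trace_sub, Matrix.trace_smul]
  unfold sigma2Mat at *
  obtain ⟨hnonneg, hle⟩ := lorentz_reverse_cauchy_schwarz hA1 hB1
    hAsymm.trace_mul_self_nonneg hBsymm.trace_mul_self_nonneg (by linarith) (by linarith)
    (hAsymm.trace_mul_sq_le hBsymm)
  rw [htrace, ← le_div_iff₀' two_pos, Real.sqrt_le_iff]
  exact ⟨by linarith, by linarith⟩
end

section
/- Let n ≥ 2 and let W be a real symmetric n×n matrix with tr W > 0 and σ₂(W) > 0. Then the first Newton transformation T₁(W) := (tr W)·Iₙ − W is positive definite. -/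
open scoped BigOperators

open Matrix in
/-- Cauchy–Schwarz for a quadratic form, in terms of the Frobenius norm of its matrix. -/
theorem sq_dotProduct_mulVec_le {ι : Type*} [Fintype ι] (A : Matrix ι ι ℝ) (x : ι → ℝ) :
    (x ⬝ᵥ A *ᵥ x) ^ 2 ≤ (Aᵀ * A).trace * (x ⬝ᵥ x) ^ 2 := by
  have hquad : x ⬝ᵥ A *ᵥ x = ∑ p : ι × ι, A p.1 p.2 * (x p.1 * x p.2) := by
    simp only [dotProduct, mulVec, Fintype.sum_prod_type, Finset.mul_sum]
    exact Finset.sum_congr rfl fun i _ => Finset.sum_congr rfl fun j _ => by ring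
  have htrace : (Aᵀ * A).trace = ∑ p : ι × ι, A p.1 p.2 ^ 2 := by
    simp only [trace, diag_apply, mul_apply, transpose_apply, Fintype.sum_prod_type, sq]
    exact Finset.sum_comm
  have hnorm : (x ⬝ᵥ x) ^ 2 = ∑ p : ι × ι, (x p.1 * x p.2) ^ 2 := by
    simp only [dotProduct, Fintype.sum_prod_type, sq, Finset.sum_mul_sum]
    exact Finset.sum_congr rfl fun i _ => Finset.sum_congr rfl fun j _ => by ring
  rw [hquad, htrace, hnorm]
  exact Finset.sum_mul_sq_le_sq_mul_sq _ _ _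

/-- For a symmetric `W` with `tr W > 0` and `σ₂(W) > 0`, the first Newton
transformation `T₁(W) = (tr W)·Iₙ − W` is positive definite. -/
theorem stmt_5 (n : ℕ) (hn : 2 ≤ n) (W : Matrix (Fin n) (Fin n) ℝ)
    (hW : W.IsSymm) (h1 : 0 < W.trace) (h2 : 0 < sigma2Mat W) :
    (W.trace • (1 : Matrix (Fin n) (Fin n) ℝ) - W).PosDef := by
  refine Matrix.PosDef.of_dotProduct_mulVec_pos ?_ fun x hx => ?_
  · rw [Matrix.IsHermitian, Matrix.conjTranspose_eq_transpose_of_trivial]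
    simp [hW.eq]
  · have hpos : 0 < x ⬝ᵥ x := by simpa using Matrix.dotProduct_star_self_pos_iff.mpr hx
    have hle := sq_dotProduct_mulVec_le W x
    rw [hW.eq] at hle
    have htr : (W * W).trace < W.trace ^ 2 := by
      unfold sigma2Mat at h2
      linarith
    have hlt : (x ⬝ᵥ W.mulVec x) ^ 2 < (W.trace * (x ⬝ᵥ x)) ^ 2 := by
      rw [mul_pow]
      exact hle.trans_lt (mul_lt_mul_of_pos_right htr (pow_pos hpos 2))
    have := lt_of_pow_lt_pow_left₀ 2 (mul_pos h1 hpos).le hlt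
    simpa [Matrix.sub_mulVec, Matrix.smul_mulVec, dotProduct_sub] using this
end

section
/- Let n ≥ 5, λ > 0 and u(x) = log(λ+|x|²) on ℝⁿ, with W(u)(x) = Hess u(x) + ∇u(x)∇u(x)ᵀ − (|∇u(x)|²/2)·Iₙ. Then ∫_{ℝⁿ} e^{(4−n)u(x)} σ₂(W(u)(x)) dx = 2n(n−1)·B·λ^{2−n/2} and ∫_{ℝⁿ} e^{−n u(x)} dx = B·λ^{−n/2}, where B = ∫_{ℝⁿ}(1+|x|²)^{−n}dx. Consequently the quotient (∫_{ℝⁿ} e^{−nu} dx)^{−(n−4)/n} · ∫_{ℝⁿ} e^{(4−n)u} σ₂(W(u)) dx equals 2n(n−1)·B^{4/n}, independent of λ. -/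
open scoped BigOperators
open MeasureTheory

/-- The Hessian matrix of `f : ℝⁿ → ℝ` at `x`. -/
noncomputable def hessMatrix (n : ℕ) (f : EuclideanSpace ℝ (Fin n) → ℝ)
    (x : EuclideanSpace ℝ (Fin n)) : Matrix (Fin n) (Fin n) ℝ :=
  Matrix.of fun i j =>
    iteratedFDeriv ℝ 2 f x ![EuclideanSpace.single i 1, EuclideanSpace.single j 1]

/-- The Schouten-tensor matrix `W(u) = Hess u + ∇u ∇uᵀ − (|∇u|²/2)·Iₙ`. -/
noncomputable def Wmat (n : ℕ) (u : EuclideanSpace ℝ (Fin n) → ℝ)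
    (x : EuclideanSpace ℝ (Fin n)) : Matrix (Fin n) (Fin n) ℝ :=
  hessMatrix n u x + Matrix.of (fun i j => gradient u x i * gradient u x j)
    - (‖gradient u x‖ ^ 2 / 2) • (1 : Matrix (Fin n) (Fin n) ℝ)

theorem hasFDerivAt_log_add_norm_sq {E : Type*} [NormedAddCommGroup E] [InnerProductSpace ℝ E]
    {lam : ℝ} (hlam : 0 < lam) (x : E) :
    HasFDerivAt (fun x : E => Real.log (lam + ‖x‖ ^ 2))
      ((2 / (lam + ‖x‖ ^ 2)) • innerSL ℝ x) x := by
  have hs : lam + ‖x‖ ^ 2 ≠ 0 := by positivity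
  have h := (((hasStrictFDerivAt_norm_sq x).hasFDerivAt).const_add lam).log hs
  convert h using 1
  ext y
  simp
  ring

theorem gradient_log_add_norm_sq {E : Type*} [NormedAddCommGroup E] [InnerProductSpace ℝ E]
    [CompleteSpace E] {lam : ℝ} (hlam : 0 < lam) (x : E) :
    gradient (fun x : E => Real.log (lam + ‖x‖ ^ 2)) x = (2 / (lam + ‖x‖ ^ 2)) • x := by
  apply HasGradientAt.gradient
  rw [hasGradientAt_iff_hasFDerivAt]
  refine (hasFDerivAt_log_add_norm_sq hlam x).congr_fderiv ?_
  ext y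
  simp

theorem fderiv_fderiv_log_add_norm_sq {E : Type*} [NormedAddCommGroup E]
    [InnerProductSpace ℝ E] {lam : ℝ} (hlam : 0 < lam) (x v w : E) :
    fderiv ℝ (fderiv ℝ (fun x : E => Real.log (lam + ‖x‖ ^ 2))) x v w =
      2 / (lam + ‖x‖ ^ 2) * inner ℝ v w -
        4 / (lam + ‖x‖ ^ 2) ^ 2 * inner ℝ x v * inner ℝ x w := by
  have hs : lam + ‖x‖ ^ 2 ≠ 0 := by positivity
  have h1 : fderiv ℝ (fun x : E => Real.log (lam + ‖x‖ ^ 2)) =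
      fun x => (2 * (lam + ‖x‖ ^ 2)⁻¹) • innerSL ℝ x := by
    ext1 y
    rw [(hasFDerivAt_log_add_norm_sq hlam y).fderiv, div_eq_mul_inv]
  have h2 : HasFDerivAt (fun y : E => lam + ‖y‖ ^ 2) (2 • innerSL ℝ x) x :=
    ((hasStrictFDerivAt_norm_sq x).hasFDerivAt).const_add lam
  have h3 := ((hasDerivAt_inv hs).comp_hasFDerivAt x h2).const_mul 2
  have h4 : HasFDerivAt (fun y : E => innerSL ℝ y) (innerSL ℝ : E →L[ℝ] E →L[ℝ] ℝ) x :=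
    (innerSL ℝ : E →L[ℝ] E →L[ℝ] ℝ).hasFDerivAt
  have h5 := h3.smul h4
  rw [h1]
  have h6 : (innerSL ℝ : E →L[ℝ] E →L[ℝ] ℝ) v w = inner ℝ v w := rfl
  refine (congrArg (fun L => L v w) h5.fderiv).trans ?_
  simp [h6]
  field_simp
  ring

theorem Wmat_log_add_norm_sq (n : ℕ) {lam : ℝ} (hlam : 0 < lam)
    (x : EuclideanSpace ℝ (Fin n)) :
    Wmat n (fun x => Real.log (lam + ‖x‖ ^ 2)) x =
      (2 * lam / (lam + ‖x‖ ^ 2) ^ 2) • (1 : Matrix (Fin n) (Fin n) ℝ) := by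
  have hs : lam + ‖x‖ ^ 2 ≠ 0 := by positivity
  ext i j
  simp only [Wmat, hessMatrix, Matrix.sub_apply, Matrix.add_apply, Matrix.of_apply,
    Matrix.smul_apply, iteratedFDeriv_two_apply, Matrix.cons_val_zero, Matrix.cons_val_one,
    fderiv_fderiv_log_add_norm_sq hlam, gradient_log_add_norm_sq hlam, norm_smul, mul_pow,
    Real.norm_eq_abs, sq_abs, PiLp.smul_apply, smul_eq_mul, EuclideanSpace.inner_single_right,
    PiLp.single_apply, Matrix.one_apply]
  by_cases hij : i = j
  · subst hij
    simp
    field_simp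
    ring
  · simp [hij, Ne.symm hij]
    field_simp
    ring

theorem sigma2Mat_smul_one (n : ℕ) (c : ℝ) :
    sigma2Mat (c • (1 : Matrix (Fin n) (Fin n) ℝ)) = n * (n - 1) / 2 * c ^ 2 := by
  simp [sigma2Mat]
  ring

theorem integral_add_norm_sq_rpow (n : ℕ) {lam : ℝ} (hlam : 0 < lam) :
    ∫ x : EuclideanSpace ℝ (Fin n), (lam + ‖x‖ ^ 2) ^ (-(n : ℝ)) =
      (∫ x : EuclideanSpace ℝ (Fin n), (1 + ‖x‖ ^ 2) ^ (-(n : ℝ))) * lam ^ (-(n : ℝ) / 2) := by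
  have h := Measure.integral_comp_smul (volume : Measure (EuclideanSpace ℝ (Fin n)))
    (fun x => (lam + ‖x‖ ^ 2) ^ (-(n : ℝ))) (√lam)
  have h1 : ∀ x : EuclideanSpace ℝ (Fin n), (lam + ‖√lam • x‖ ^ 2) ^ (-(n : ℝ)) =
      lam ^ (-(n : ℝ)) * (1 + ‖x‖ ^ 2) ^ (-(n : ℝ)) := fun x => by
    rw [← Real.mul_rpow hlam.le (by positivity), norm_smul, mul_pow, Real.norm_eq_abs, sq_abs,
      Real.sq_sqrt hlam.le]
    ring_nf
  have h2 : |(√lam ^ n)⁻¹| = lam ^ (-(n : ℝ) / 2) := by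
    rw [abs_of_pos (by positivity), Real.sqrt_eq_rpow, ← Real.rpow_natCast, ← Real.rpow_mul hlam.le,
      ← Real.rpow_neg hlam.le]
    ring_nf
  simp only [h1, integral_const_mul, finrank_euclideanSpace_fin, h2, smul_eq_mul] at h
  have h3 : lam ^ (-(n : ℝ)) = lam ^ (-(n : ℝ) / 2) * lam ^ (-(n : ℝ) / 2) := by
    rw [← Real.rpow_add hlam]
    ring_nf
  have h4 : lam ^ (-(n : ℝ) / 2) ≠ 0 := by positivity
  rw [h3, mul_assoc] at h
  rw [← mul_left_cancel₀ h4 h, mul_comm]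

/-- For the standard bubble `u(x) = log(λ+|x|²)` on `ℝⁿ`, `n ≥ 5`:
`∫ e^{(4−n)u} σ₂(W(u)) dx = 2n(n−1)·B·λ^{2−n/2}`, `∫ e^{−nu} dx = B·λ^{−n/2}`,
and the Yamabe-type quotient equals `2n(n−1)·B^{4/n}`, independently of `λ`. -/
theorem stmt_9 (n : ℕ) (hn : 5 ≤ n) (lam : ℝ) (hlam : 0 < lam)
    (u : EuclideanSpace ℝ (Fin n) → ℝ) (hu : ∀ x, u x = Real.log (lam + ‖x‖ ^ 2))
    (B : ℝ) (hB : B = ∫ x : EuclideanSpace ℝ (Fin n), (1 + ‖x‖ ^ 2) ^ (-(n : ℝ))) :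
    (∫ x : EuclideanSpace ℝ (Fin n),
        Real.exp ((4 - (n : ℝ)) * u x) * sigma2Mat (Wmat n u x) =
      2 * n * (n - 1) * B * lam ^ (2 - (n : ℝ) / 2)) ∧
    (∫ x : EuclideanSpace ℝ (Fin n), Real.exp (-(n : ℝ) * u x) =
      B * lam ^ (-(n : ℝ) / 2)) ∧
    (∫ x : EuclideanSpace ℝ (Fin n), Real.exp (-(n : ℝ) * u x)) ^
        (-(((n : ℝ) - 4) / n)) *
      (∫ x : EuclideanSpace ℝ (Fin n),
        Real.exp ((4 - (n : ℝ)) * u x) * sigma2Mat (Wmat n u x)) =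
      2 * n * (n - 1) * B ^ ((4 : ℝ) / n) := by
  have hn0 : (n : ℝ) ≠ 0 := by positivity
  have hB0 : 0 ≤ B := hB ▸ integral_nonneg fun x => by positivity
  have hexp : ∀ (a : ℝ) (x : EuclideanSpace ℝ (Fin n)),
      Real.exp (a * u x) = (lam + ‖x‖ ^ 2) ^ a := fun a x => by
    rw [hu, Real.rpow_def_of_pos (by positivity), mul_comm]
  have hvol : ∫ x, Real.exp (-(n : ℝ) * u x) = B * lam ^ (-(n : ℝ) / 2) := by
    simp only [hexp]
    rw [integral_add_norm_sq_rpow n hlam, hB]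
  have hpt : ∀ x, Real.exp ((4 - (n : ℝ)) * u x) * sigma2Mat (Wmat n u x) =
      2 * n * (n - 1) * lam ^ 2 * Real.exp (-(n : ℝ) * u x) := fun x => by
    have hs : 0 < lam + ‖x‖ ^ 2 := by positivity
    rw [hexp, hexp, funext hu, Wmat_log_add_norm_sq n hlam, sigma2Mat_smul_one, sub_eq_add_neg,
      Real.rpow_add hs, show (4 : ℝ) = (4 : ℕ) by norm_num, Real.rpow_natCast]
    field_simp
  have hsig : ∫ x, Real.exp ((4 - (n : ℝ)) * u x) * sigma2Mat (Wmat n u x) =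
      2 * n * (n - 1) * B * lam ^ (2 - (n : ℝ) / 2) := by
    simp only [hpt, integral_const_mul]
    rw [hvol, sub_eq_add_neg 2, Real.rpow_add hlam, Real.rpow_two, neg_div]
    ring
  refine ⟨hsig, hvol, ?_⟩
  have hlam_exp : (lam ^ (-(n : ℝ) / 2)) ^ (-(((n : ℝ) - 4) / n)) * lam ^ (2 - (n : ℝ) / 2) = 1 := by
    rw [← Real.rpow_mul hlam.le, ← Real.rpow_add hlam, ← Real.rpow_zero lam]
    congr 1
    field_simp
    ring
  have hB_exp : B ^ (-(((n : ℝ) - 4) / n)) * B = B ^ ((4 : ℝ) / n) := by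
    rcases hB0.eq_or_lt with h | h
    · rw [← h, mul_zero, Real.zero_rpow (by positivity)]
    · rw [← Real.rpow_add_one h.ne']
      congr 1
      field_simp
      ring
  rw [hsig, hvol, Real.mul_rpow hB0 (by positivity), ← hB_exp]
  linear_combination (2 * n * (n - 1) * (B ^ (-(((n : ℝ) - 4) / n)) * B)) * hlam_exp
end

section
/- Let n ≥ 5 and a₁ > 0. Define α(r) = 2/(1 + 2a₁ r^{(n−4)/2}) for r > 0 and u(x) = (4/(4−n))·log( |x|^{(4−n)/2} + 2a₁ ) on ℝⁿ∖{0}. Then: (i) r·α′(r) = −((n−4)/4)·(2α(r) − α(r)²) for all r > 0, and |x|·u′(|x|) = α(|x|); (ii) for every x ≠ 0, σ₂(W(u)(x)) = 0 and σ₁(W(u)(x)) = (n/2)·(2α(|x|)−α(|x|)²)/(2|x|²) > 0. -/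
open scoped BigOperators

/-- The norm of a real inner product space is differentiable away from the origin. -/
theorem hasFDerivAt_norm_of_ne_zero {E : Type*} [NormedAddCommGroup E] [InnerProductSpace ℝ E]
    {x : E} (hx : x ≠ 0) :
    HasFDerivAt (fun y : E => ‖y‖) (‖x‖⁻¹ • innerSL ℝ x) x := by
  have hr : ‖x‖ ≠ 0 := norm_ne_zero_iff.mpr hx
  have h := (hasStrictFDerivAt_norm_sq x).hasFDerivAt.sqrt (pow_ne_zero 2 hr)
  simp only [Real.sqrt_sq (norm_nonneg _)] at h
  refine h.congr_fderiv ?_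
  ext v
  simp
  field_simp

/-- The derivative of a radial function whose profile has derivative `r * β r`. -/
theorem hasFDerivAt_radial {E : Type*} [NormedAddCommGroup E] [InnerProductSpace ℝ E]
    {φ β : ℝ → ℝ} (hφ : ∀ r, 0 < r → HasDerivAt φ (r * β r) r) {x : E} (hx : x ≠ 0) :
    HasFDerivAt (fun y : E => φ ‖y‖) (β ‖x‖ • innerSL ℝ x) x := by
  have hr : 0 < ‖x‖ := norm_pos_iff.mpr hx
  have h := (hφ _ hr).comp_hasFDerivAt x (hasFDerivAt_norm_of_ne_zero hx)
  refine h.congr_fderiv ?_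
  ext v
  simp
  field_simp

/-- The second derivative of a radial function. -/
theorem iteratedFDeriv_two_radial {E : Type*} [NormedAddCommGroup E] [InnerProductSpace ℝ E]
    {φ β : ℝ → ℝ} (hφ : ∀ r, 0 < r → HasDerivAt φ (r * β r) r) {x : E} (hx : x ≠ 0)
    {γ : ℝ} (hβ : HasDerivAt β γ ‖x‖) (v w : E) :
    iteratedFDeriv ℝ 2 (fun y : E => φ ‖y‖) x ![v, w] =
      β ‖x‖ * inner ℝ v w + γ / ‖x‖ * inner ℝ x v * inner ℝ x w := by
  have hev : fderiv ℝ (fun y : E => φ ‖y‖) =ᶠ[nhds x] fun y => β ‖y‖ • innerSL ℝ y := by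
    filter_upwards [isOpen_ne.mem_nhds hx] with y hy
    exact (hasFDerivAt_radial hφ hy).fderiv
  have h1 : HasFDerivAt (fun y : E => β ‖y‖) (γ • (‖x‖⁻¹ • innerSL ℝ x)) x :=
    hβ.comp_hasFDerivAt x (hasFDerivAt_norm_of_ne_zero hx)
  have h2 : HasFDerivAt (fun y : E => innerSL ℝ y) (innerSL ℝ : E →L[ℝ] E →L[ℝ] ℝ) x :=
    (innerSL ℝ : E →L[ℝ] E →L[ℝ] ℝ).hasFDerivAt
  rw [iteratedFDeriv_two_apply, hev.fderiv_eq, (h1.fun_smul h2).fderiv]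
  simp
  rw [innerSL_apply_apply]
  ring

/-- The gradient of a radial function on Euclidean space. -/
theorem gradient_radial {n : ℕ} {φ β : ℝ → ℝ} (hφ : ∀ r, 0 < r → HasDerivAt φ (r * β r) r)
    {x : EuclideanSpace ℝ (Fin n)} (hx : x ≠ 0) :
    gradient (fun y : EuclideanSpace ℝ (Fin n) => φ ‖y‖) x = β ‖x‖ • x := by
  refine HasGradientAt.gradient ?_
  rw [hasGradientAt_iff_hasFDerivAt]
  refine (hasFDerivAt_radial hφ hx).congr_fderiv ?_
  ext v
  simp

/-- The Schouten matrix of a radial function is a combination of the identity and `x xᵀ`. -/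
theorem Wmat_radial {n : ℕ} {φ β : ℝ → ℝ} (hφ : ∀ r, 0 < r → HasDerivAt φ (r * β r) r)
    {x : EuclideanSpace ℝ (Fin n)} (hx : x ≠ 0) {γ : ℝ} (hβ : HasDerivAt β γ ‖x‖) :
    Wmat n (fun y => φ ‖y‖) x =
      (β ‖x‖ - β ‖x‖ ^ 2 * ‖x‖ ^ 2 / 2) • (1 : Matrix (Fin n) (Fin n) ℝ) +
        (γ / ‖x‖ + β ‖x‖ ^ 2) • Matrix.vecMulVec x.ofLp x.ofLp := by
  ext i j
  simp only [Wmat, hessMatrix, gradient_radial hφ hx, Matrix.sub_apply, Matrix.add_apply,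
    Matrix.of_apply, iteratedFDeriv_two_radial hφ hx hβ, norm_smul, Matrix.smul_apply,
    Matrix.vecMulVec_apply, EuclideanSpace.inner_single_right, Matrix.one_apply]
  by_cases hij : i = j
  · subst hij
    simp [mul_pow]
    ring
  · simp [hij, Ne.symm hij]
    ring

/-- The dot product of a Euclidean vector with itself is its squared norm. -/
theorem dotProduct_self_ofLp {n : ℕ} (x : EuclideanSpace ℝ (Fin n)) :
    x.ofLp ⬝ᵥ x.ofLp = ‖x‖ ^ 2 := by
  rw [EuclideanSpace.real_norm_sq_eq]
  simp only [dotProduct, pow_two]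

/-- The trace of `a I + b x xᵀ`. -/
theorem trace_smul_one_add_smul_vecMulVec {n : ℕ} (a b : ℝ) (x : EuclideanSpace ℝ (Fin n)) :
    (a • (1 : Matrix (Fin n) (Fin n) ℝ) + b • Matrix.vecMulVec x.ofLp x.ofLp).trace =
      a * n + b * ‖x‖ ^ 2 := by
  simp [Matrix.trace_add, Matrix.trace_vecMulVec, dotProduct_self_ofLp]

/-- The second elementary symmetric function of `a I + b x xᵀ`. -/
theorem sigma2Mat_smul_one_add_smul_vecMulVec {n : ℕ} (a b : ℝ)
    (x : EuclideanSpace ℝ (Fin n)) :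
    sigma2Mat (a • (1 : Matrix (Fin n) (Fin n) ℝ) + b • Matrix.vecMulVec x.ofLp x.ofLp) =
      ((a * n + b * ‖x‖ ^ 2) ^ 2 -
        (a ^ 2 * n + (2 * a * b + b ^ 2 * ‖x‖ ^ 2) * ‖x‖ ^ 2)) / 2 := by
  have hsq : (a • (1 : Matrix (Fin n) (Fin n) ℝ) + b • Matrix.vecMulVec x.ofLp x.ofLp) *
      (a • (1 : Matrix (Fin n) (Fin n) ℝ) + b • Matrix.vecMulVec x.ofLp x.ofLp) =
      (a ^ 2) • (1 : Matrix (Fin n) (Fin n) ℝ) +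
        (2 * a * b + b ^ 2 * ‖x‖ ^ 2) • Matrix.vecMulVec x.ofLp x.ofLp := by
    have hv : Matrix.vecMulVec x.ofLp x.ofLp * Matrix.vecMulVec x.ofLp x.ofLp =
        ‖x‖ ^ 2 • Matrix.vecMulVec x.ofLp x.ofLp := by
      rw [Matrix.vecMulVec_mul_vecMulVec, dotProduct_self_ofLp]
      ext i j
      simp [Matrix.vecMulVec_apply]
      ring
    simp only [add_mul, mul_add, Matrix.smul_mul, Matrix.mul_smul, one_mul, mul_one, hv]
    module
  rw [sigma2Mat, hsq, trace_smul_one_add_smul_vecMulVec, trace_smul_one_add_smul_vecMulVec]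

/-- The exact neck profile: for `n ≥ 5`, `a₁ > 0`, `α(r) = 2/(1+2a₁ r^{(n−4)/2})`
and `u(x) = (4/(4−n)) log(|x|^{(4−n)/2} + 2a₁)`, the Bernoulli ODE
`rα′ = −((n−4)/4)(2α−α²)` holds, `r·u′(r) = α(r)`, and the metric `e^{−2u}g_eucl`
is σ₂-flat with positive scalar curvature:
`σ₂(W(u)) = 0` and `σ₁(W(u)) = (n/2)·(2α−α²)/(2|x|²) > 0`. -/
theorem stmt_13 (n : ℕ) (hn : 5 ≤ n) (a₁ : ℝ) (ha₁ : 0 < a₁)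
    (α : ℝ → ℝ) (hα : ∀ r : ℝ, α r = 2 / (1 + 2 * a₁ * r ^ (((n : ℝ) - 4) / 2)))
    (φ : ℝ → ℝ) (hφ : ∀ r : ℝ, φ r = (4 / (4 - (n : ℝ))) *
      Real.log (r ^ ((4 - (n : ℝ)) / 2) + 2 * a₁))
    (u : EuclideanSpace ℝ (Fin n) → ℝ) (hu : ∀ x, u x = φ ‖x‖) :
    (∀ r : ℝ, 0 < r →
      r * deriv α r = -(((n : ℝ) - 4) / 4) * (2 * α r - (α r) ^ 2) ∧
      r * deriv φ r = α r) ∧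
    (∀ x : EuclideanSpace ℝ (Fin n), x ≠ 0 →
      sigma2Mat (Wmat n u x) = 0 ∧
      (Wmat n u x).trace = ((n : ℝ) / 2) * (2 * α ‖x‖ - (α ‖x‖) ^ 2) / (2 * ‖x‖ ^ 2) ∧
      0 < (Wmat n u x).trace) := by
  obtain rfl : u = fun x => φ ‖x‖ := funext hu
  have hn' : (5 : ℝ) ≤ n := by exact_mod_cast hn
  have h4 : (4 : ℝ) - n ≠ 0 := by linarith
  have hαd : ∀ r : ℝ, 0 < r →
      HasDerivAt α (-(((n : ℝ) - 4) / 4) * (2 * α r - (α r) ^ 2) / r) r := by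
    intro r hr
    have hp : 0 < r ^ (((n : ℝ) - 4) / 2) := Real.rpow_pos_of_pos hr _
    have hden : 1 + 2 * a₁ * r ^ (((n : ℝ) - 4) / 2) ≠ 0 := by positivity
    have h := (((Real.hasDerivAt_rpow_const (p := ((n : ℝ) - 4) / 2)
      (Or.inl hr.ne')).const_mul (2 * a₁)).const_add 1).fun_inv hden |>.const_mul 2
    rw [funext hα]
    simp only [div_eq_mul_inv (2 : ℝ) (1 + _)]
    refine h.congr_deriv ?_
    rw [Real.rpow_sub_one hr.ne']
    field_simp
    ring
  have hφd : ∀ r : ℝ, 0 < r → HasDerivAt φ (r * (α r / r ^ 2)) r := by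
    intro r hr
    have hp : 0 < r ^ (((n : ℝ) - 4) / 2) := Real.rpow_pos_of_pos hr _
    have hq : r ^ ((4 - (n : ℝ)) / 2) = (r ^ (((n : ℝ) - 4) / 2))⁻¹ := by
      rw [← Real.rpow_neg hr.le]
      congr 1
      ring
    have hq0 : 0 < r ^ ((4 - (n : ℝ)) / 2) := Real.rpow_pos_of_pos hr _
    have hden : r ^ ((4 - (n : ℝ)) / 2) + 2 * a₁ ≠ 0 := by positivity
    have h := (((Real.hasDerivAt_rpow_const (p := (4 - (n : ℝ)) / 2)
      (Or.inl hr.ne')).add_const (2 * a₁)).log hden).const_mul (4 / (4 - (n : ℝ)))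
    rw [funext hφ]
    refine h.congr_deriv ?_
    rw [Real.rpow_sub_one hr.ne', hα, hq]
    field_simp
    ring
  refine ⟨fun r hr => ⟨?_, ?_⟩, fun x hx => ?_⟩
  · rw [(hαd r hr).deriv]
    field_simp
  · rw [(hφd r hr).deriv]
    field_simp
  · have hr : 0 < ‖x‖ := norm_pos_iff.mpr hx
    have hpos : 0 < 2 * α ‖x‖ - α ‖x‖ ^ 2 := by
      have hp : 0 < ‖x‖ ^ (((n : ℝ) - 4) / 2) := Real.rpow_pos_of_pos hr _
      have h : 2 * α ‖x‖ - α ‖x‖ ^ 2 = 8 * a₁ * ‖x‖ ^ (((n : ℝ) - 4) / 2) /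
          (1 + 2 * a₁ * ‖x‖ ^ (((n : ℝ) - 4) / 2)) ^ 2 := by
        rw [hα]
        field_simp
        ring
      rw [h]
      positivity
    have hβ := (hαd _ hr).fun_div (hasDerivAt_pow 2 ‖x‖) (pow_ne_zero 2 hr.ne')
    have hW := Wmat_radial (β := fun r => α r / r ^ 2) hφd hx hβ
    have htr : (Wmat n (fun y => φ ‖y‖) x).trace =
        ((n : ℝ) / 2) * (2 * α ‖x‖ - (α ‖x‖) ^ 2) / (2 * ‖x‖ ^ 2) := by
      rw [hW, trace_smul_one_add_smul_vecMulVec]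
      push_cast
      field_simp
      ring
    refine ⟨?_, htr, ?_⟩
    · rw [hW, sigma2Mat_smul_one_add_smul_vecMulVec]
      push_cast
      field_simp
      ring
    · rw [htr]
      positivity
end

section
/- (Flat-background integral identity for σ₂.) Let n ≥ 5 and let u be a smooth compactly supported function on ℝⁿ. Then 2·∫_{ℝⁿ} σ₂(W(u)(x))·e^{(4−n)u(x)} dx = ((n−4)/2)·∫_{ℝⁿ} σ₁(W(u)(x))·|∇u(x)|²·e^{(4−n)u(x)} dx + ((n−4)/4)·∫_{ℝⁿ} |∇u(x)|⁴·e^{(4−n)u(x)} dx. -/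
open scoped BigOperators
open MeasureTheory

section PartialDerivatives

variable {n : ℕ} {f g : EuclideanSpace ℝ (Fin n) → ℝ}

/-- The partial derivative of `f` in the `i`-th coordinate direction. -/
noncomputable def partialDeriv (i : Fin n) (f : EuclideanSpace ℝ (Fin n) → ℝ)
    (x : EuclideanSpace ℝ (Fin n)) : ℝ :=
  fderiv ℝ f x (EuclideanSpace.single i 1)

lemma ContDiff.partialDeriv (hf : ContDiff ℝ (⊤ : ℕ∞) f) (i : Fin n) :
    ContDiff ℝ (⊤ : ℕ∞) (partialDeriv i f) :=
  (hf.fderiv_right (m := (⊤ : ℕ∞)) (by simp)).clm_apply contDiff_const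

lemma partialDeriv_add (i : Fin n) {x : EuclideanSpace ℝ (Fin n)} (hf : DifferentiableAt ℝ f x)
    (hg : DifferentiableAt ℝ g x) :
    partialDeriv i (fun y => f y + g y) x = partialDeriv i f x + partialDeriv i g x := by
  simp [partialDeriv, fderiv_fun_add hf hg]

lemma partialDeriv_sub (i : Fin n) {x : EuclideanSpace ℝ (Fin n)} (hf : DifferentiableAt ℝ f x)
    (hg : DifferentiableAt ℝ g x) :
    partialDeriv i (fun y => f y - g y) x = partialDeriv i f x - partialDeriv i g x := by
  simp [partialDeriv, fderiv_fun_sub hf hg]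

lemma partialDeriv_mul (i : Fin n) {x : EuclideanSpace ℝ (Fin n)} (hf : DifferentiableAt ℝ f x)
    (hg : DifferentiableAt ℝ g x) :
    partialDeriv i (fun y => f y * g y) x = partialDeriv i f x * g x + f x * partialDeriv i g x := by
  simp [partialDeriv, fderiv_fun_mul hf hg]
  ring

lemma partialDeriv_const_mul (i : Fin n) {x : EuclideanSpace ℝ (Fin n)} (c : ℝ)
    (hf : DifferentiableAt ℝ f x) :
    partialDeriv i (fun y => c * f y) x = c * partialDeriv i f x := by
  simp [partialDeriv, fderiv_const_mul hf]

lemma partialDeriv_exp_mul (i : Fin n) {x : EuclideanSpace ℝ (Fin n)} (c : ℝ)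
    (hf : DifferentiableAt ℝ f x) :
    partialDeriv i (fun y => Real.exp (c * f y)) x
      = c * partialDeriv i f x * Real.exp (c * f x) := by
  simp [partialDeriv, fderiv_exp (hf.const_mul c), fderiv_const_mul hf]
  ring

lemma partialDeriv_partialDeriv (hf : ContDiff ℝ (⊤ : ℕ∞) f) (i j : Fin n)
    (x : EuclideanSpace ℝ (Fin n)) :
    partialDeriv i (partialDeriv j f) x =
      fderiv ℝ (fderiv ℝ f) x (EuclideanSpace.single i 1) (EuclideanSpace.single j 1) := by
  have hd : DifferentiableAt ℝ (fderiv ℝ f) x :=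
    (hf.fderiv_right (m := (⊤ : ℕ∞)) (by simp)).differentiable (by simp) x
  change fderiv ℝ (fun y => fderiv ℝ f y (EuclideanSpace.single j 1)) x _ = _
  rw [fderiv_clm_apply hd (differentiableAt_const _)]
  simp

lemma partialDeriv_comm (hf : ContDiff ℝ (⊤ : ℕ∞) f) (i j : Fin n)
    (x : EuclideanSpace ℝ (Fin n)) :
    partialDeriv i (partialDeriv j f) x = partialDeriv j (partialDeriv i f) x := by
  rw [partialDeriv_partialDeriv hf, partialDeriv_partialDeriv hf]
  exact (hf.contDiffAt.isSymmSndFDerivAt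
    (by simpa using WithTop.coe_le_coe.2 (le_top : (2 : ℕ∞) ≤ ⊤))) _ _

lemma partialDeriv_eq_zero_of_notMem_tsupport (i : Fin n) {x : EuclideanSpace ℝ (Fin n)}
    (hx : x ∉ tsupport f) : partialDeriv i f x = 0 := by
  have : x ∉ Function.support (fderiv ℝ f) := fun h => hx (support_fderiv_subset ℝ h)
  simp [partialDeriv, Function.notMem_support.mp this]

lemma tsupport_partialDeriv_subset (i : Fin n) :
    tsupport (partialDeriv i f) ⊆ tsupport f :=
  closure_minimal (fun _ hx => by_contra fun h =>
    hx (partialDeriv_eq_zero_of_notMem_tsupport i h)) (isClosed_tsupport f)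

lemma integral_partialDeriv_eq_zero (hf : ContDiff ℝ 1 f) (hs : HasCompactSupport f) (i : Fin n) :
    ∫ x, partialDeriv i f x = 0 := by
  have hc : Continuous (partialDeriv i f) :=
    (hf.continuous_fderiv (by simp)).clm_apply continuous_const
  have hi : Integrable (partialDeriv i f) :=
    hc.integrable_of_hasCompactSupport
      (hs.of_isClosed_subset (isClosed_tsupport _) (tsupport_partialDeriv_subset i))
  have h := integral_mul_fderiv_eq_neg_fderiv_mul_of_integrable
    (μ := (volume : Measure (EuclideanSpace ℝ (Fin n)))) (𝕜 := ℝ)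
    (f := fun _ => (1 : ℝ)) (g := f) (v := EuclideanSpace.single i 1)
    (by simp) (by simp only [one_mul]; exact hi)
    (by simpa using hf.continuous.integrable_of_hasCompactSupport hs)
    (fun _ _ => differentiableAt_const _) (fun x _ => hf.differentiable (by simp) x)
  simpa [partialDeriv] using h

lemma gradient_apply (f : EuclideanSpace ℝ (Fin n) → ℝ) (x : EuclideanSpace ℝ (Fin n))
    (i : Fin n) : gradient f x i = partialDeriv i f x := by
  have h := inner_gradient_left (𝕜 := ℝ) (f := f) (x := x) (y := EuclideanSpace.single i (1 : ℝ))
  rw [EuclideanSpace.inner_single_right] at h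
  simpa [partialDeriv] using h

lemma norm_gradient_sq (f : EuclideanSpace ℝ (Fin n) → ℝ) (x : EuclideanSpace ℝ (Fin n)) :
    ‖gradient f x‖ ^ 2 = ∑ i, partialDeriv i f x ^ 2 := by
  simp [EuclideanSpace.real_norm_sq_eq, gradient_apply]

lemma norm_gradient_sq_eq_dotProduct (f : EuclideanSpace ℝ (Fin n) → ℝ)
    (x : EuclideanSpace ℝ (Fin n)) :
    ‖gradient f x‖ ^ 2 = (fun i => partialDeriv i f x) ⬝ᵥ fun i => partialDeriv i f x := by
  rw [norm_gradient_sq]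
  simp [dotProduct, sq]

end PartialDerivatives

section Algebra

variable {n : ℕ} (H : Matrix (Fin n) (Fin n) ℝ) (p : Fin n → ℝ)

/-- The matrix `H + p pᵀ − (|p|²/2)·Iₙ`. -/
noncomputable def schoutenMatrix : Matrix (Fin n) (Fin n) ℝ :=
  H + Matrix.vecMulVec p p - ((p ⬝ᵥ p) / 2) • (1 : Matrix (Fin n) (Fin n) ℝ)

lemma trace_schoutenMatrix :
    (schoutenMatrix H p).trace = H.trace + (1 - n / 2) * (p ⬝ᵥ p) := by
  simp [schoutenMatrix, Matrix.trace_vecMulVec]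
  ring

lemma trace_schoutenMatrix_mul_self :
    (schoutenMatrix H p * schoutenMatrix H p).trace =
      (H * H).trace + n / 4 * (p ⬝ᵥ p) ^ 2 + 2 * (p ⬝ᵥ H.mulVec p) - (p ⬝ᵥ p) * H.trace := by
  have h₁ : (H * Matrix.vecMulVec p p).trace = p ⬝ᵥ H.mulVec p := by
    rw [Matrix.mul_vecMulVec, Matrix.trace_vecMulVec, dotProduct_comm]
  have h₂ : (Matrix.vecMulVec p p * H).trace = p ⬝ᵥ H.mulVec p := by
    rw [Matrix.trace_mul_comm, h₁]
  have h₃ : (Matrix.vecMulVec p p * Matrix.vecMulVec p p).trace = (p ⬝ᵥ p) ^ 2 := by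
    rw [Matrix.mul_vecMulVec, Matrix.trace_vecMulVec, Matrix.vecMulVec_mulVec]
    simp [sq]
  simp only [schoutenMatrix, sub_mul, mul_sub, add_mul, mul_add, Matrix.smul_mul, Matrix.mul_smul,
    Matrix.one_mul, Matrix.mul_one, Matrix.trace_sub, Matrix.trace_add, Matrix.trace_smul, h₁, h₂,
    h₃, Matrix.trace_vecMulVec, Matrix.trace_one, smul_eq_mul, Fintype.card_fin]
  ring

/-- The algebraic identity behind the divergence form of `σ₂`; `T i j k` stands for the
`i`-th derivative of the entry `H j k`. -/
lemma two_sigma2Mat_schoutenMatrix_sub (T : Fin n → Fin n → Fin n → ℝ)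
    (hH : ∀ i j, H i j = H j i) (hT : ∀ i j, T i i j = T j i i) :
    2 * sigma2Mat (schoutenMatrix H p)
        - ((n : ℝ) - 4) / 2 * ((schoutenMatrix H p).trace * (p ⬝ᵥ p))
        - ((n : ℝ) - 4) / 4 * (p ⬝ᵥ p) ^ 2 =
      ∑ i, ∑ j, (T i j j * p i + H j j * H i i - (T i i j * p j + H i j * H i j)
        + (1 - n / 2) * (2 * (p j * H i j * p i) + p j ^ 2 * H i i)
        + (4 - n) * p i * (H j j * p i - H i j * p j + (1 - n / 2) * (p j ^ 2 * p i))) := by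
  have hT' : ∑ i, ∑ j, T i i j * p j = ∑ i, ∑ j, T i j j * p i := by
    rw [Finset.sum_comm]
    simp only [hT]
  have hN : (H * H).trace = ∑ i, ∑ j, H i j * H i j := by
    simp only [Matrix.trace, Matrix.diag, Matrix.mul_apply]
    exact Finset.sum_congr rfl fun i _ => Finset.sum_congr rfl fun j _ => by rw [hH j i]
  have hq : p ⬝ᵥ H.mulVec p = ∑ i, ∑ j, p j * H i j * p i := by
    simp only [dotProduct, Matrix.mulVec, Finset.mul_sum]
    exact Finset.sum_congr rfl fun i _ => Finset.sum_congr rfl fun j _ => by ring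
  have hΔ : ∑ i, ∑ j, H j j * H i i = H.trace ^ 2 := by
    simp only [Matrix.trace, Matrix.diag, sq, Finset.sum_mul_sum]
    exact Finset.sum_comm
  have hsΔ : ∑ i, ∑ j, p j ^ 2 * H i i = (p ⬝ᵥ p) * H.trace := by
    rw [mul_comm]
    simp only [Matrix.trace, Matrix.diag, dotProduct, Finset.sum_mul_sum]
    exact Finset.sum_congr rfl fun i _ => Finset.sum_congr rfl fun j _ => by ring
  have hsΔ' : ∑ i, ∑ j, p i ^ 2 * H j j = (p ⬝ᵥ p) * H.trace := by
    rw [Finset.sum_comm, hsΔ]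
  have hs : ∑ i, ∑ j, p j ^ 2 * p i ^ 2 = (p ⬝ᵥ p) ^ 2 := by
    simp only [sq, dotProduct, Finset.sum_mul_sum]
    exact Finset.sum_congr rfl fun i _ => Finset.sum_congr rfl fun j _ => by ring
  have hsum : ∑ i, ∑ j, (T i j j * p i + H j j * H i i - (T i i j * p j + H i j * H i j)
        + (1 - n / 2) * (2 * (p j * H i j * p i) + p j ^ 2 * H i i)
        + (4 - n) * p i * (H j j * p i - H i j * p j + (1 - n / 2) * (p j ^ 2 * p i))) =
      ∑ i, ∑ j, T i j j * p i + ∑ i, ∑ j, H j j * H i i - ∑ i, ∑ j, T i i j * p j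
        - ∑ i, ∑ j, H i j * H i j
        + (2 * (1 - n / 2) - (4 - n)) * ∑ i, ∑ j, p j * H i j * p i
        + (1 - n / 2) * ∑ i, ∑ j, p j ^ 2 * H i i
        + (4 - n) * ∑ i, ∑ j, p i ^ 2 * H j j
        + (4 - n) * (1 - n / 2) * ∑ i, ∑ j, p j ^ 2 * p i ^ 2 := by
    simp only [Finset.mul_sum, ← Finset.sum_add_distrib, ← Finset.sum_sub_distrib]
    exact Finset.sum_congr rfl fun i _ => Finset.sum_congr rfl fun j _ => by ring
  rw [hsum, hT', hΔ, hsΔ, hsΔ', hs, ← hN, ← hq, sigma2Mat, trace_schoutenMatrix_mul_self,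
    trace_schoutenMatrix]
  ring

end Algebra

lemma Wmat_eq_schoutenMatrix {n : ℕ} {u : EuclideanSpace ℝ (Fin n) → ℝ}
    (hu : ContDiff ℝ (⊤ : ℕ∞) u) (x : EuclideanSpace ℝ (Fin n)) :
    Wmat n u x = schoutenMatrix (Matrix.of fun i j => partialDeriv i (partialDeriv j u) x)
      (fun i => partialDeriv i u x) := by
  rw [Wmat, schoutenMatrix, norm_gradient_sq_eq_dotProduct]
  congr 2
  · ext i j
    simp [hessMatrix, iteratedFDeriv_two_apply, partialDeriv_partialDeriv hu]
  · ext i j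
    simp [gradient_apply, Matrix.vecMulVec_apply]

/-- The `(i, j)` summand of the divergence whose integral yields the `σ₂` identity. -/
noncomputable def sigma2Flux {n : ℕ} (u : EuclideanSpace ℝ (Fin n) → ℝ) (i j : Fin n)
    (x : EuclideanSpace ℝ (Fin n)) : ℝ :=
  (partialDeriv j (partialDeriv j u) x * partialDeriv i u x
    - partialDeriv i (partialDeriv j u) x * partialDeriv j u x
    + (1 - n / 2) * (partialDeriv j u x * partialDeriv j u x * partialDeriv i u x))
    * Real.exp ((4 - (n : ℝ)) * u x)

section Flux

variable {n : ℕ} {u : EuclideanSpace ℝ (Fin n) → ℝ}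

lemma contDiff_sigma2Flux (hu : ContDiff ℝ (⊤ : ℕ∞) u) (i j : Fin n) :
    ContDiff ℝ (⊤ : ℕ∞) (sigma2Flux u i j) := by
  have hp := hu.partialDeriv
  have hh := fun i j => (hp j).partialDeriv i
  exact (((hh j j).mul (hp i)).sub ((hh i j).mul (hp j)) |>.add
    (contDiff_const.mul (((hp j).mul (hp j)).mul (hp i)))).mul (contDiff_const.mul hu).exp

lemma hasCompactSupport_sigma2Flux (hs : HasCompactSupport u) (i j : Fin n) :
    HasCompactSupport (sigma2Flux u i j) :=
  HasCompactSupport.intro hs fun x hx => by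
    simp [sigma2Flux, partialDeriv_eq_zero_of_notMem_tsupport _ hx]

lemma partialDeriv_sigma2Flux (hu : ContDiff ℝ (⊤ : ℕ∞) u) (i j : Fin n)
    (x : EuclideanSpace ℝ (Fin n)) :
    partialDeriv i (sigma2Flux u i j) x =
      (partialDeriv i (partialDeriv j (partialDeriv j u)) x * partialDeriv i u x
        + partialDeriv j (partialDeriv j u) x * partialDeriv i (partialDeriv i u) x
        - (partialDeriv i (partialDeriv i (partialDeriv j u)) x * partialDeriv j u x
          + partialDeriv i (partialDeriv j u) x * partialDeriv i (partialDeriv j u) x)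
        + (1 - n / 2) * (2 * (partialDeriv j u x * partialDeriv i (partialDeriv j u) x
            * partialDeriv i u x)
          + partialDeriv j u x ^ 2 * partialDeriv i (partialDeriv i u) x)
        + (4 - n) * partialDeriv i u x * (partialDeriv j (partialDeriv j u) x * partialDeriv i u x
          - partialDeriv i (partialDeriv j u) x * partialDeriv j u x
          + (1 - n / 2) * (partialDeriv j u x ^ 2 * partialDeriv i u x)))
        * Real.exp ((4 - (n : ℝ)) * u x) := by
  have d : ∀ {f : EuclideanSpace ℝ (Fin n) → ℝ}, ContDiff ℝ (⊤ : ℕ∞) f → DifferentiableAt ℝ f x :=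
    fun hf => hf.differentiable (by simp) x
  have hp : ∀ i, DifferentiableAt ℝ (partialDeriv i u) x := fun i => d (hu.partialDeriv i)
  have hh : ∀ i j, DifferentiableAt ℝ (partialDeriv i (partialDeriv j u)) x :=
    fun i j => d ((hu.partialDeriv j).partialDeriv i)
  have h₁ := (hh j j).fun_mul (hp i)
  have h₂ := (hh i j).fun_mul (hp j)
  have h₃ := (hp j).fun_mul (hp j)
  have h₄ := h₃.fun_mul (hp i)
  unfold sigma2Flux
  rw [partialDeriv_mul i ((h₁.fun_sub h₂).fun_add (h₄.const_mul _)) ((d hu).const_mul _).exp,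
    partialDeriv_add i (h₁.fun_sub h₂) (h₄.const_mul _), partialDeriv_sub i h₁ h₂,
    partialDeriv_mul i (hh j j) (hp i), partialDeriv_mul i (hh i j) (hp j),
    partialDeriv_const_mul i _ h₄, partialDeriv_mul i h₃ (hp i), partialDeriv_mul i (hp j) (hp j),
    partialDeriv_exp_mul i _ (d hu)]
  ring

lemma sum_partialDeriv_sigma2Flux (hu : ContDiff ℝ (⊤ : ℕ∞) u) (x : EuclideanSpace ℝ (Fin n)) :
    2 * (sigma2Mat (Wmat n u x) * Real.exp ((4 - (n : ℝ)) * u x))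
        - ((n : ℝ) - 4) / 2 *
          ((Wmat n u x).trace * ‖gradient u x‖ ^ 2 * Real.exp ((4 - (n : ℝ)) * u x))
        - ((n : ℝ) - 4) / 4 * (‖gradient u x‖ ^ 4 * Real.exp ((4 - (n : ℝ)) * u x)) =
      ∑ i, ∑ j, partialDeriv i (sigma2Flux u i j) x := by
  have hT : ∀ i j, partialDeriv i (partialDeriv i (partialDeriv j u)) x
      = partialDeriv j (partialDeriv i (partialDeriv i u)) x := fun i j => by
    rw [show partialDeriv i (partialDeriv j u) = partialDeriv j (partialDeriv i u) from
      funext (partialDeriv_comm hu i j), partialDeriv_comm (hu.partialDeriv i)]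
  have key := two_sigma2Mat_schoutenMatrix_sub
    (Matrix.of fun i j => partialDeriv i (partialDeriv j u) x) (fun i => partialDeriv i u x)
    (fun i j k => partialDeriv i (partialDeriv j (partialDeriv k u)) x)
    (fun i j => partialDeriv_comm hu i j x) hT
  simp only [partialDeriv_sigma2Flux hu, ← Finset.sum_mul]
  simp only [Matrix.of_apply] at key
  rw [← key, ← Wmat_eq_schoutenMatrix hu,
    ← norm_gradient_sq_eq_dotProduct]
  ring

lemma continuous_Wmat (hu : ContDiff ℝ (⊤ : ℕ∞) u) : Continuous (Wmat n u) := by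
  have hp := fun i => (hu.partialDeriv i).continuous
  have hh := fun i j => ((hu.partialDeriv j).partialDeriv i).continuous
  rw [funext (Wmat_eq_schoutenMatrix hu)]
  unfold schoutenMatrix
  have hp' : Continuous fun x => (fun i => partialDeriv i u x) := continuous_pi hp
  exact ((continuous_matrix hh).add (hp'.matrix_vecMulVec hp')).sub
    (((hp'.dotProduct hp').div_const 2).smul continuous_const)

lemma continuous_norm_gradient_sq (hu : ContDiff ℝ (⊤ : ℕ∞) u) :
    Continuous fun x => ‖gradient u x‖ ^ 2 := by
  simp only [norm_gradient_sq]
  exact continuous_finsetSum _ fun i _ => (hu.partialDeriv i).continuous.pow 2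

lemma gradient_eq_zero_of_notMem_tsupport {x : EuclideanSpace ℝ (Fin n)} (hx : x ∉ tsupport u) :
    gradient u x = 0 := by
  ext i
  simp [gradient_apply, partialDeriv_eq_zero_of_notMem_tsupport i hx]

lemma Wmat_eq_zero_of_notMem_tsupport (hu : ContDiff ℝ (⊤ : ℕ∞) u)
    {x : EuclideanSpace ℝ (Fin n)} (hx : x ∉ tsupport u) : Wmat n u x = 0 := by
  rw [Wmat_eq_schoutenMatrix hu]
  ext i j
  simp [schoutenMatrix, partialDeriv_eq_zero_of_notMem_tsupport _ hx,
    partialDeriv_eq_zero_of_notMem_tsupport i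
      (fun h => hx (tsupport_partialDeriv_subset j h)), Matrix.vecMulVec_apply, dotProduct]

end Flux

/-- Flat-background integral identity for `σ₂`: for `n ≥ 5` and smooth compactly
supported `u` on `ℝⁿ`,
`2∫ σ₂(W(u)) e^{(4−n)u} = ((n−4)/2)∫ σ₁(W(u))|∇u|² e^{(4−n)u}
  + ((n−4)/4)∫ |∇u|⁴ e^{(4−n)u}`. -/
theorem stmt_16 (n : ℕ) (hn : 5 ≤ n) (u : EuclideanSpace ℝ (Fin n) → ℝ)
    (hu : ContDiff ℝ (⊤ : ℕ∞) u) (hsupp : HasCompactSupport u) :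
    2 * ∫ x : EuclideanSpace ℝ (Fin n),
        sigma2Mat (Wmat n u x) * Real.exp ((4 - (n : ℝ)) * u x) =
      ((n : ℝ) - 4) / 2 *
        (∫ x : EuclideanSpace ℝ (Fin n),
          (Wmat n u x).trace * ‖gradient u x‖ ^ 2 * Real.exp ((4 - (n : ℝ)) * u x)) +
      ((n : ℝ) - 4) / 4 *
        (∫ x : EuclideanSpace ℝ (Fin n),
          ‖gradient u x‖ ^ 4 * Real.exp ((4 - (n : ℝ)) * u x)) := by
  have hE : Continuous fun x => Real.exp ((4 - (n : ℝ)) * u x) :=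
    Real.continuous_exp.comp (continuous_const.mul hu.continuous)
  have hW := continuous_Wmat hu
  have hG := continuous_norm_gradient_sq hu
  have hA : Integrable fun x => sigma2Mat (Wmat n u x) * Real.exp ((4 - (n : ℝ)) * u x) :=
    Continuous.integrable_of_hasCompactSupport
      ((((hW.matrix_trace.pow 2).sub (hW.matrix_mul hW).matrix_trace).div_const 2).mul hE)
      (HasCompactSupport.intro hsupp fun x hx => by
        simp [Wmat_eq_zero_of_notMem_tsupport hu hx, sigma2Mat])
  have hB : Integrable fun x =>
      (Wmat n u x).trace * ‖gradient u x‖ ^ 2 * Real.exp ((4 - (n : ℝ)) * u x) :=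
    Continuous.integrable_of_hasCompactSupport ((hW.matrix_trace.mul hG).mul hE)
      (HasCompactSupport.intro hsupp fun x hx => by
        simp [gradient_eq_zero_of_notMem_tsupport hx])
  have hC : Integrable fun x => ‖gradient u x‖ ^ 4 * Real.exp ((4 - (n : ℝ)) * u x) := by
    refine Continuous.integrable_of_hasCompactSupport (Continuous.mul ?_ hE)
      (HasCompactSupport.intro hsupp fun x hx => by
        simp [gradient_eq_zero_of_notMem_tsupport hx])
    exact (hG.pow 2).congr fun x => by simp only [Pi.pow_apply]; ring
  have hF : ∀ i j, Integrable (partialDeriv i (sigma2Flux u i j)) := fun i j =>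
    ((contDiff_sigma2Flux hu i j).partialDeriv i).continuous.integrable_of_hasCompactSupport
      ((hasCompactSupport_sigma2Flux hsupp i j).of_isClosed_subset (isClosed_tsupport _)
        (tsupport_partialDeriv_subset i))
  have h := integral_congr_ae (μ := volume) (.of_forall (sum_partialDeriv_sigma2Flux hu))
  rw [integral_sub (by exact (hA.const_mul _).sub (hB.const_mul _)) (hC.const_mul _),
    integral_sub (hA.const_mul _) (hB.const_mul _), integral_const_mul, integral_const_mul,
    integral_const_mul, integral_finsetSum _ fun i _ => integrable_finsetSum _ fun j _ => hF i j,
    Finset.sum_eq_zero fun i _ => ?_] at h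
  · linarith
  · rw [integral_finsetSum _ fun j _ => hF i j]
    exact Finset.sum_eq_zero fun j _ => integral_partialDeriv_eq_zero
      ((contDiff_sigma2Flux hu i j).of_le (by simp)) (hasCompactSupport_sigma2Flux hsupp i j) i
end
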